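/- Fix a > 0, γ ∈ [1,2], ν > 0, and constants 0 < ς̲₀ ≤ ς̄₀ and Ē > 0. There exists a constant η̲ > 0, depending only on (a, γ, ν, ς̄₀, ς̲₀, Ē), with the following property: for every global smooth solution (η, w) of the 1D isentropic compressible Navier–Stokes system on [0,∞) × T whose initial data satisfy ς̲₀ ≤ η₀ ≤ ς̄₀, ∫_T η₀ dx = 1, ∫_T η₀ w₀ dx = 0 and E₀₀ := ∫_T ( (1/2) η₀ w₀² + P(η₀) ) dx ≤ Ē, one has η(t,x) ≥ η̲ for all t ≥ 0 and all x ∈ T. -/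

import Mathlib

open MeasureTheory

/-- The pressure potential `P` associated with the pressure law `p(s) = a s^γ`:
`P(s) = a s^γ/(γ-1)` if `γ > 1` and `P(s) = a (s log s + 1)` if `γ = 1`. -/
noncomputable def Ppot (a γ : ℝ) (s : ℝ) : ℝ :=
  if γ = 1 then a * (s * Real.log s + 1) else a * s ^ γ / (γ - 1)

open Set Filter Topology Function

/-- The derivative of the pressure potential. -/
noncomputable def enthalpy (a γ : ℝ) (s : ℝ) : ℝ :=
  if γ = 1 then a * (Real.log s + 1) else a * γ / (γ - 1) * s ^ (γ - 1)

lemma hasDerivAt_Ppot (a γ : ℝ) {s : ℝ} (hs : 0 < s) :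
    HasDerivAt (Ppot a γ) (enthalpy a γ s) s := by
  by_cases h : γ = 1
  · have e : Ppot a γ = fun s => a * (s * Real.log s + 1) := by
      funext s; simp [Ppot, h]
    rw [e]
    have := (((hasDerivAt_id s).mul (Real.hasDerivAt_log hs.ne')).add_const 1).const_mul a
    refine this.congr_deriv ?_
    simp [enthalpy, h, hs.ne']
  · have e : Ppot a γ = fun s => a * s ^ γ / (γ - 1) := by
      funext s; simp [Ppot, h]
    rw [e]
    have := ((Real.hasDerivAt_rpow_const (p := γ) (Or.inl hs.ne')).const_mul a).div_const (γ - 1)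
    refine this.congr_deriv ?_
    simp only [enthalpy, h, if_false]
    ring

lemma hasDerivAt_enthalpy (a γ : ℝ) {s : ℝ} (hs : 0 < s) :
    HasDerivAt (enthalpy a γ) (a * γ * s ^ (γ - 2)) s := by
  by_cases h : γ = 1
  · have e : enthalpy a γ = fun s => a * (Real.log s + 1) := by
      funext s; simp [enthalpy, h]
    rw [e]
    have := ((Real.hasDerivAt_log hs.ne').add_const 1).const_mul a
    refine this.congr_deriv ?_
    rw [h, show (1 : ℝ) - 2 = -1 by norm_num, Real.rpow_neg_one]
    ring
  · have e : enthalpy a γ = fun s => a * γ / (γ - 1) * s ^ (γ - 1) := by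
      funext s; simp [enthalpy, h]
    rw [e]
    have := (Real.hasDerivAt_rpow_const (p := γ - 1) (Or.inl hs.ne')).const_mul (a * γ / (γ - 1))
    refine this.congr_deriv ?_
    have h' : γ - 1 ≠ 0 := sub_ne_zero.2 h
    rw [show γ - 1 - 1 = γ - 2 by ring]
    field_simp

lemma Ppot_nonneg {a γ s : ℝ} (ha : 0 < a) (hγ : 1 ≤ γ) (hs : 0 < s) : 0 ≤ Ppot a γ s := by
  unfold Ppot
  split_ifs with h
  · have h1 := Real.one_sub_inv_le_log_of_pos hs
    have h2 : s * (1 - s⁻¹) ≤ s * Real.log s := by gcongr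
    have h3 : s * (1 - s⁻¹) = s - 1 := by field_simp
    have : 0 ≤ s * Real.log s + 1 := by linarith
    positivity
  · have : 0 < γ - 1 := lt_of_le_of_ne (by linarith) (Ne.symm (sub_ne_zero.2 h))
    positivity

lemma exists_partial_derivatives {f : ℝ → ℝ → ℝ} (hf : ContDiff ℝ (⊤ : ℕ∞) (uncurry f)) :
    ∃ ft fx : ℝ → ℝ → ℝ, ContDiff ℝ (⊤ : ℕ∞) (uncurry ft) ∧ ContDiff ℝ (⊤ : ℕ∞) (uncurry fx) ∧
      (∀ t x, HasDerivAt (fun s => f s x) (ft t x) t) ∧ ∀ t x, HasDerivAt (f t) (fx t x) x := by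
  have hd : ContDiff ℝ (⊤ : ℕ∞) (fderiv ℝ (uncurry f)) := hf.fderiv_right (by simp)
  refine ⟨fun t x => fderiv ℝ (uncurry f) (t, x) (1, 0),
    fun t x => fderiv ℝ (uncurry f) (t, x) (0, 1),
    hd.clm_apply contDiff_const, hd.clm_apply contDiff_const, fun t x => ?_, fun t x => ?_⟩
  · have h1 : HasFDerivAt (uncurry f) (fderiv ℝ (uncurry f) (t, x)) (t, x) :=
      (hf.differentiable (by simp) _).hasFDerivAt
    have h2 : HasDerivAt (fun s : ℝ => (s, x)) ((1 : ℝ), (0 : ℝ)) t :=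
      (hasDerivAt_id t).prodMk (hasDerivAt_const t x)
    exact h1.comp_hasDerivAt t h2
  · have h1 : HasFDerivAt (uncurry f) (fderiv ℝ (uncurry f) (t, x)) (t, x) :=
      (hf.differentiable (by simp) _).hasFDerivAt
    have h2 : HasDerivAt (fun s : ℝ => (t, s)) ((0 : ℝ), (1 : ℝ)) x :=
      (hasDerivAt_const x t).prodMk (hasDerivAt_id x)
    exact h1.comp_hasDerivAt x h2

/-- A density `f` whose flux `Q` balances over one period has nonincreasing integral. -/
lemma integral_le_initial_of_flux {f ft Q Qx : ℝ → ℝ → ℝ}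
    (hft : ∀ t x, 0 ≤ t → HasDerivAt (fun s => f s x) (ft t x) t)
    (hftc : ContinuousOn (uncurry ft) (Ici 0 ×ˢ univ))
    (hfc : ∀ t, 0 ≤ t → Continuous (f t))
    (hQ : ∀ t x, 0 ≤ t → HasDerivAt (Q t) (Qx t x) x)
    (hQc : ∀ t, 0 ≤ t → Continuous (Qx t))
    (hper : ∀ t, 0 ≤ t → Q t 1 = Q t 0)
    (hle : ∀ t x, 0 ≤ t → ft t x + Qx t x ≤ 0) {t : ℝ} (ht : 0 ≤ t) :
    ∫ x in (0 : ℝ)..1, f t x ≤ ∫ x in (0 : ℝ)..1, f 0 x := by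
  have hslice : ∀ s, 0 ≤ s → Continuous (ft s) := fun s hs => by
    rw [← continuousOn_univ]
    exact hftc.comp (f := fun x => (s, x)) (by fun_prop) (fun x _ => ⟨hs, mem_univ _⟩)
  have hslice' : ∀ x, ContinuousOn (fun s => ft s x) (Ici 0) := fun x =>
    hftc.comp (f := fun s => (s, x)) (by fun_prop) (fun s hs => ⟨hs, mem_univ _⟩)
  have hsub : uIcc 0 t ⊆ Ici 0 := by
    rw [uIcc_of_le ht]; exact Icc_subset_Ici_self
  have hftc' : ∀ x, ∫ s in (0 : ℝ)..t, ft s x = f t x - f 0 x := fun x =>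
    intervalIntegral.integral_eq_sub_of_hasDerivAt (f := fun s => f s x)
      (fun s hs => hft s x (hsub hs))
      ((hslice' x).mono hsub).intervalIntegrable
  have hnonpos : ∀ s, 0 ≤ s → ∫ x in (0 : ℝ)..1, ft s x ≤ 0 := fun s hs => by
    have h1 : ∫ x in (0 : ℝ)..1, Qx s x = 0 := by
      rw [intervalIntegral.integral_eq_sub_of_hasDerivAt (fun x _ => hQ s x hs)
        ((hQc s hs).intervalIntegrable _ _), hper s hs, sub_self]
    have h2 : ∫ x in (0 : ℝ)..1, ft s x ≤ ∫ x in (0 : ℝ)..1, -Qx s x :=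
      intervalIntegral.integral_mono_on zero_le_one ((hslice s hs).intervalIntegrable _ _)
        ((hQc s hs).neg.intervalIntegrable _ _) (fun x _ => by linarith [hle s x hs])
    rwa [intervalIntegral.integral_neg, h1, neg_zero] at h2
  have hint : IntegrableOn (uncurry fun x s => ft s x) (uIoc 0 1 ×ˢ uIoc 0 t) := by
    have hc : ContinuousOn (uncurry fun x s => ft s x) (uIcc 0 1 ×ˢ uIcc 0 t) :=
      hftc.comp (f := Prod.swap) (by fun_prop) (fun p hp => ⟨hsub hp.2, mem_univ _⟩)
    exact (hc.integrableOn_compact (isCompact_uIcc.prod isCompact_uIcc)).mono_set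
      (prod_mono uIoc_subset_uIcc uIoc_subset_uIcc)
  have hswap := intervalIntegral_intervalIntegral_swap hint
  simp only [hftc'] at hswap
  rw [intervalIntegral.integral_sub ((hfc t ht).intervalIntegrable _ _)
    ((hfc 0 le_rfl).intervalIntegrable _ _)] at hswap
  have : 0 ≤ ∫ s in (0 : ℝ)..t, -∫ x in (0 : ℝ)..1, ft s x :=
    intervalIntegral.integral_nonneg ht fun s hs => neg_nonneg.2 (hnonpos s hs.1)
  rw [intervalIntegral.integral_neg] at this
  linarith

lemma integral_eq_initial_of_flux {f ft Q Qx : ℝ → ℝ → ℝ}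
    (hft : ∀ t x, 0 ≤ t → HasDerivAt (fun s => f s x) (ft t x) t)
    (hftc : ContinuousOn (uncurry ft) (Ici 0 ×ˢ univ))
    (hfc : ∀ t, 0 ≤ t → Continuous (f t))
    (hQ : ∀ t x, 0 ≤ t → HasDerivAt (Q t) (Qx t x) x)
    (hQc : ∀ t, 0 ≤ t → Continuous (Qx t))
    (hper : ∀ t, 0 ≤ t → Q t 1 = Q t 0)
    (heq : ∀ t x, 0 ≤ t → ft t x + Qx t x = 0) {t : ℝ} (ht : 0 ≤ t) :
    ∫ x in (0 : ℝ)..1, f t x = ∫ x in (0 : ℝ)..1, f 0 x := by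
  refine le_antisymm (integral_le_initial_of_flux hft hftc hfc hQ hQc hper
    (fun t x h => (heq t x h).le) ht) ?_
  have := integral_le_initial_of_flux (f := fun t x => -f t x) (ft := fun t x => -ft t x)
    (Q := fun t x => -Q t x) (Qx := fun t x => -Qx t x)
    (fun t x h => (hft t x h).neg) hftc.neg (fun t h => (hfc t h).neg)
    (fun t x h => (hQ t x h).neg) (fun t h => (hQc t h).neg)
    (fun t h => by rw [hper t h]) (fun t x h => by linarith [heq t x h]) ht
  simpa only [intervalIntegral.integral_neg, neg_le_neg_iff] using this

lemma deriv_nonpos_of_isMinOn_left {f : ℝ → ℝ} {f' t : ℝ} (ht : 0 < t)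
    (hf : HasDerivAt f f' t) (hmin : ∀ s ∈ Icc 0 t, f t ≤ f s) : f' ≤ 0 := by
  have h1 : Tendsto (slope f t) (𝓝[<] t) (𝓝 f') :=
    (hasDerivAt_iff_tendsto_slope.1 hf).mono_left
      (nhdsWithin_mono t fun s (hs : s < t) => hs.ne)
  refine le_of_tendsto h1 ?_
  filter_upwards [Ioo_mem_nhdsLT ht] with s hs
  rw [slope_def_field]
  exact div_nonpos_of_nonneg_of_nonpos (by linarith [hmin s ⟨hs.1.le, hs.2.le⟩])
    (by linarith [hs.2])

/-- Minimum principle: a periodic function that does not decrease in time at its spatial critical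
points below level `m` stays above `m`. -/
lemma le_of_critical_points {L Lt : ℝ → ℝ → ℝ} {m : ℝ}
    (hc : ContinuousOn (uncurry L) (Ici 0 ×ˢ univ))
    (hper : ∀ t, 0 ≤ t → Periodic (L t) 1)
    (h0 : ∀ x, m ≤ L 0 x)
    (ht : ∀ t x, 0 < t → HasDerivAt (fun s => L s x) (Lt t x) t)
    (hcrit : ∀ t x, 0 < t → x ∈ Icc (0 : ℝ) 1 → deriv (L t) x = 0 → L t x < m → 0 ≤ Lt t x)
    {t x : ℝ} (h : 0 ≤ t) : m ≤ L t x := by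
  have reduce : ∀ (y : ℝ), ∃ z ∈ Icc (0 : ℝ) 1, ∀ s, 0 ≤ s → L s y = L s z := fun y =>
    ⟨Int.fract y, ⟨Int.fract_nonneg y, (Int.fract_lt_one y).le⟩, fun s hs => by
      have := (hper s hs).sub_int_mul_eq (x := y) ⌊y⌋
      rw [mul_one] at this
      exact this.symm⟩
  have key : ∀ ε > 0, m ≤ L t x + ε * t := by
    intro ε hε
    have hK : IsCompact (Icc 0 t ×ˢ Icc (0 : ℝ) 1) := isCompact_Icc.prod isCompact_Icc
    have hcε : ContinuousOn (fun p : ℝ × ℝ => L p.1 p.2 + ε * p.1) (Icc 0 t ×ˢ Icc (0 : ℝ) 1) :=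
      (hc.mono (prod_mono Icc_subset_Ici_self (subset_univ _))).add (by fun_prop)
    obtain ⟨⟨t', x'⟩, ⟨ht', hx'⟩, hmin⟩ :=
      hK.exists_isMinOn ⟨(0, 0), ⟨⟨le_rfl, h⟩, ⟨le_rfl, zero_le_one⟩⟩⟩ hcε
    have hmin' : ∀ s y, s ∈ Icc 0 t → L t' x' + ε * t' ≤ L s y + ε * s := by
      intro s y hs
      obtain ⟨z, hz, e⟩ := reduce y
      rw [e s hs.1]
      exact hmin (show (s, z) ∈ Icc 0 t ×ˢ Icc (0 : ℝ) 1 from ⟨hs, hz⟩)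
    refine le_trans ?_ (hmin' t x ⟨h, le_rfl⟩)
    by_contra! hlt
    have ht'0 : 0 ≤ t' := ht'.1
    rcases ht'0.eq_or_lt with h' | h'
    · rw [← h'] at hlt
      linarith [h0 x']
    · have hεt : 0 < ε * t' := mul_pos hε h'
      have hdx : deriv (L t') x' = 0 :=
        IsLocalMin.deriv_eq_zero (Eventually.of_forall fun y => by linarith [hmin' t' y ht'])
      have hdt : Lt t' x' + ε ≤ 0 :=
        deriv_nonpos_of_isMinOn_left (f := fun s => L s x' + ε * s) h'
          ((ht t' x' h').add (by simpa using (hasDerivAt_id t').const_mul ε))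
          (fun s hs => hmin' s x' ⟨hs.1, hs.2.trans ht'.2⟩)
      linarith [hcrit t' x' h' hx' hdx (by linarith)]
  refine le_of_forall_pos_le_add fun δ hδ => (key (δ / (t + 1)) (by positivity)).trans ?_
  have : δ / (t + 1) * t ≤ δ := by
    rw [div_mul_eq_mul_div, div_le_iff₀ (by positivity)]
    nlinarith
  linarith

/-- Differentiation in the parameter of an integral of a jointly continuous family. -/
lemma hasDerivAt_integral_of_continuous {f ft : ℝ → ℝ → ℝ} (hfc : ∀ t, Continuous (f t))
    (hft : ∀ t x, HasDerivAt (fun s => f s x) (ft t x) t) (hftc : Continuous (uncurry ft))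
    (b t : ℝ) :
    HasDerivAt (fun s => ∫ x in (0 : ℝ)..b, f s x) (∫ x in (0 : ℝ)..b, ft t x) t := by
  obtain ⟨C, hC⟩ := ((isCompact_Icc (a := t - 1) (b := t + 1)).prod
    (isCompact_uIcc (a := (0 : ℝ)) (b := b))).exists_bound_of_continuousOn hftc.continuousOn
  refine (intervalIntegral.hasDerivAt_integral_of_dominated_loc_of_deriv_le
    (F := f) (F' := ft) (bound := fun _ => C) (s := Icc (t - 1) (t + 1))
    (Icc_mem_nhds (by linarith) (by linarith))
    (Eventually.of_forall fun s => (hfc s).aestronglyMeasurable)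
    ((hfc t).intervalIntegrable _ _)
    (hftc.uncurry_left t).aestronglyMeasurable
    (Eventually.of_forall fun x hx s hs => hC (s, x) ⟨hs, uIoc_subset_uIcc hx⟩)
    intervalIntegrable_const
    (Eventually.of_forall fun x _ s _ => hft s x)).2

lemma hasDerivAt_pressure (a γ : ℝ) {f : ℝ → ℝ} {f' x : ℝ} (hf : HasDerivAt f f' x)
    (hpos : 0 < f x) :
    HasDerivAt (fun y => a * f y ^ γ) (a * γ * f x ^ (γ - 1) * f') x :=
  ((hf.rpow_const (p := γ) (Or.inl hpos.ne')).const_mul a).congr_deriv (by ring)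

/-- A classical `1`-periodic solution of the compressible Navier–Stokes system for positive times,
together with its partial derivatives. -/
structure IsPeriodicFlow (a γ ν : ℝ) (η ηt ηx w wt wx wxx : ℝ → ℝ → ℝ) : Prop where
  cont_η : Continuous (uncurry η)
  cont_ηt : Continuous (uncurry ηt)
  cont_ηx : Continuous (uncurry ηx)
  cont_w : Continuous (uncurry w)
  cont_wt : Continuous (uncurry wt)
  cont_wx : Continuous (uncurry wx)
  cont_wxx : Continuous (uncurry wxx)
  deriv_ηt : ∀ t x, HasDerivAt (fun s => η s x) (ηt t x) t
  deriv_ηx : ∀ t x, HasDerivAt (η t) (ηx t x) x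
  deriv_wt : ∀ t x, HasDerivAt (fun s => w s x) (wt t x) t
  deriv_wx : ∀ t x, HasDerivAt (w t) (wx t x) x
  deriv_wxx : ∀ t x, HasDerivAt (wx t) (wxx t x) x
  periodic_η : ∀ t, Periodic (η t) 1
  periodic_w : ∀ t, Periodic (w t) 1
  pos : ∀ t x, 0 ≤ t → 0 < η t x
  mass : ∀ t x, 0 ≤ t → ηt t x + (ηx t x * w t x + η t x * wx t x) = 0
  momentum : ∀ t x, 0 ≤ t → η t x * (wt t x + w t x * wx t x) - ν * wxx t x
    + a * γ * η t x ^ (γ - 1) * ηx t x = 0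

namespace IsPeriodicFlow

variable {a γ ν : ℝ} {η ηt ηx w wt wx wxx : ℝ → ℝ → ℝ}

lemma periodic_wx (h : IsPeriodicFlow a γ ν η ηt ηx w wt wx wxx) (t : ℝ) :
    Periodic (wx t) 1 := fun x => by
  have h1 : HasDerivAt (fun y => w t (y + 1)) (wx t (x + 1)) x :=
    (h.deriv_wx t (x + 1)).comp_add_const x 1
  rw [show (fun y => w t (y + 1)) = w t from funext (h.periodic_w t)] at h1
  exact h1.unique (h.deriv_wx t x)

lemma continuous_rpow (h : IsPeriodicFlow a γ ν η ηt ηx w wt wx wxx) {t : ℝ} (ht : 0 ≤ t)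
    (p : ℝ) : Continuous fun x => η t x ^ p :=
  (h.cont_η.uncurry_left t).rpow_const fun x => Or.inl (h.pos t x ht).ne'

lemma integral_density (h : IsPeriodicFlow a γ ν η ηt ηx w wt wx wxx) {t : ℝ} (ht : 0 ≤ t) :
    ∫ x in (0 : ℝ)..1, η t x = ∫ x in (0 : ℝ)..1, η 0 x := by
  refine integral_eq_initial_of_flux (f := η) (ft := ηt) (Q := fun t x => η t x * w t x)
    (Qx := fun t x => ηx t x * w t x + η t x * wx t x) (fun t x _ => h.deriv_ηt t x)
    h.cont_ηt.continuousOn (fun t _ => h.cont_η.uncurry_left t)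
    (fun t x _ => (h.deriv_ηx t x).mul (h.deriv_wx t x)) (fun t _ => ?_) (fun t _ => ?_)
    h.mass ht
  · have := h.cont_η.uncurry_left t
    have := h.cont_ηx.uncurry_left t
    have := h.cont_w.uncurry_left t
    have := h.cont_wx.uncurry_left t
    fun_prop
  · have h1 := h.periodic_η t 0
    have h2 := h.periodic_w t 0
    rw [zero_add] at h1 h2
    simp only [h1, h2]

lemma hasDerivAt_momentum_flux (h : IsPeriodicFlow a γ ν η ηt ηx w wt wx wxx) {t : ℝ}
    (ht : 0 ≤ t) (x : ℝ) :
    HasDerivAt (fun y => η t y * w t y ^ 2 + a * η t y ^ γ - ν * wx t y)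
      (-(ηt t x * w t x + η t x * wt t x)) x := by
  refine ((((h.deriv_ηx t x).mul ((h.deriv_wx t x).pow 2)).add
    (hasDerivAt_pressure a γ (h.deriv_ηx t x) (h.pos t x ht))).sub ((h.deriv_wxx t x).const_mul ν)).congr_deriv ?_
  have h1 := h.mass t x ht
  have h2 := h.momentum t x ht
  push_cast
  simp only [Pi.pow_apply]
  linear_combination h2 + w t x * h1

lemma continuous_momentum_flux (h : IsPeriodicFlow a γ ν η ηt ηx w wt wx wxx) {t : ℝ}
    (ht : 0 ≤ t) :
    Continuous fun y => η t y * w t y ^ 2 + a * η t y ^ γ - ν * wx t y :=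
  continuous_iff_continuousAt.2 fun x => (h.hasDerivAt_momentum_flux ht x).continuousAt

lemma continuous_momentum (h : IsPeriodicFlow a γ ν η ηt ηx w wt wx wxx) :
    Continuous (uncurry fun t x => η t x * w t x) :=
  h.cont_η.mul h.cont_w

lemma continuous_momentum_deriv (h : IsPeriodicFlow a γ ν η ηt ηx w wt wx wxx) :
    Continuous (uncurry fun t x => ηt t x * w t x + η t x * wt t x) :=
  (h.cont_ηt.mul h.cont_w).add (h.cont_η.mul h.cont_wt)

lemma integral_momentum (h : IsPeriodicFlow a γ ν η ηt ηx w wt wx wxx) {t : ℝ} (ht : 0 ≤ t) :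
    ∫ x in (0 : ℝ)..1, η t x * w t x = ∫ x in (0 : ℝ)..1, η 0 x * w 0 x := by
  refine integral_eq_initial_of_flux (f := fun t x => η t x * w t x)
    (fun t x _ => (h.deriv_ηt t x).mul (h.deriv_wt t x))
    h.continuous_momentum_deriv.continuousOn
    (fun t _ => h.continuous_momentum.uncurry_left t)
    (fun t x ht => h.hasDerivAt_momentum_flux ht x)
    (fun t _ => (h.continuous_momentum_deriv.uncurry_left t).neg) (fun t _ => ?_)
    (fun t x _ => add_neg_cancel _) ht
  have h1 := h.periodic_η t 0
  have h2 := h.periodic_w t 0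
  have h3 := h.periodic_wx t 0
  rw [zero_add] at h1 h2 h3
  simp only [h1, h2, h3]

lemma continuousOn_enthalpy (h : IsPeriodicFlow a γ ν η ηt ηx w wt wx wxx) :
    ContinuousOn (uncurry fun t x => enthalpy a γ (η t x)) (Ici 0 ×ˢ univ) := fun p hp =>
  ((hasDerivAt_enthalpy a γ (h.pos p.1 p.2 hp.1)).continuousAt.comp
    (f := uncurry η) h.cont_η.continuousAt).continuousWithinAt

lemma continuous_energy_density (h : IsPeriodicFlow a γ ν η ηt ηx w wt wx wxx) {t : ℝ}
    (ht : 0 ≤ t) :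
    Continuous fun x => (1 / 2) * η t x * w t x ^ 2 + Ppot a γ (η t x) := by
  have h1 := h.cont_η.uncurry_left t
  have h2 := h.cont_w.uncurry_left t
  have h3 : Continuous fun x => Ppot a γ (η t x) := continuous_iff_continuousAt.2 fun x =>
    (hasDerivAt_Ppot a γ (h.pos t x ht)).continuousAt.comp h1.continuousAt
  fun_prop

lemma integral_energy_le (h : IsPeriodicFlow a γ ν η ηt ηx w wt wx wxx) (hν : 0 < ν) {t : ℝ}
    (ht : 0 ≤ t) :
    ∫ x in (0 : ℝ)..1, ((1 / 2) * η t x * w t x ^ 2 + Ppot a γ (η t x)) ≤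
      ∫ x in (0 : ℝ)..1, ((1 / 2) * η 0 x * w 0 x ^ 2 + Ppot a γ (η 0 x)) := by
  refine integral_le_initial_of_flux
    (f := fun t x => (1 / 2) * η t x * w t x ^ 2 + Ppot a γ (η t x))
    (ft := fun t x => (1 / 2) * ηt t x * w t x ^ 2 + η t x * w t x * wt t x
      + enthalpy a γ (η t x) * ηt t x)
    (Q := fun t x => (1 / 2) * η t x * w t x ^ 3 + enthalpy a γ (η t x) * (η t x * w t x)
      - ν * (w t x * wx t x))
    (Qx := fun t x => (1 / 2) * ηx t x * w t x ^ 3 + (3 / 2) * η t x * w t x ^ 2 * wx t x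
      + (a * γ * η t x ^ (γ - 1) * ηx t x * w t x
        + enthalpy a γ (η t x) * (ηx t x * w t x + η t x * wx t x))
      - ν * (wx t x ^ 2 + w t x * wxx t x))
    (fun t x ht => ?_) ?_ (fun t ht => h.continuous_energy_density ht) (fun t x ht => ?_)
    (fun t ht => ?_) (fun t _ => ?_) (fun t x ht => ?_) ht
  · refine ((((h.deriv_ηt t x).const_mul (1 / 2)).mul ((h.deriv_wt t x).pow 2)).add
      ((hasDerivAt_Ppot a γ (h.pos t x ht)).comp t (h.deriv_ηt t x))).congr_deriv ?_
    push_cast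
    simp only [Pi.pow_apply]
    ring
  · have h1 := h.cont_η
    have h2 := h.cont_w
    have h3 := h.cont_ηt
    have h4 := h.cont_wt
    exact (Continuous.continuousOn (by fun_prop :
      Continuous fun p : ℝ × ℝ => (1 / 2) * uncurry ηt p * uncurry w p ^ 2
        + uncurry η p * uncurry w p * uncurry wt p)).add
        (h.continuousOn_enthalpy.mul h3.continuousOn)
  · refine (((((h.deriv_ηx t x).const_mul (1 / 2)).mul ((h.deriv_wx t x).pow 3)).add
      (((hasDerivAt_enthalpy a γ (h.pos t x ht)).comp x (h.deriv_ηx t x)).mul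
        ((h.deriv_ηx t x).mul (h.deriv_wx t x)))).sub
      (((h.deriv_wx t x).mul (h.deriv_wxx t x)).const_mul ν)).congr_deriv ?_
    have e : η t x ^ (γ - 1) = η t x ^ (γ - 2) * η t x := by
      rw [← Real.rpow_add_one (h.pos t x ht).ne']
      ring_nf
    rw [e]
    push_cast
    simp only [Pi.pow_apply, Pi.mul_apply, comp_apply]
    ring
  · have h1 := h.cont_η.uncurry_left t
    have h2 := h.cont_ηx.uncurry_left t
    have h3 := h.cont_w.uncurry_left t
    have h4 := h.cont_wx.uncurry_left t
    have h5 := h.cont_wxx.uncurry_left t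
    have h6 := h.continuous_rpow ht (γ - 1)
    have h7 : Continuous fun x => enthalpy a γ (η t x) := continuous_iff_continuousAt.2 fun x =>
      (hasDerivAt_enthalpy a γ (h.pos t x ht)).continuousAt.comp h1.continuousAt
    fun_prop
  · have h1 := h.periodic_η t 0
    have h2 := h.periodic_w t 0
    have h3 := h.periodic_wx t 0
    rw [zero_add] at h1 h2 h3
    simp only [h1, h2, h3]
  · have h1 := h.mass t x ht
    have h2 := h.momentum t x ht
    have h3 : 0 ≤ ν * wx t x ^ 2 := by positivity
    linear_combination h3 + w t x * h2 + (w t x ^ 2 / 2 + enthalpy a γ (η t x)) * h1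

lemma integral_abs_momentum_le (h : IsPeriodicFlow a γ ν η ηt ηx w wt wx wxx) (ha : 0 < a)
    (hγ : 1 ≤ γ) (hν : 0 < ν) (hmass : ∫ x in (0 : ℝ)..1, η 0 x = 1) {E : ℝ}
    (hE : ∫ x in (0 : ℝ)..1, ((1 / 2) * η 0 x * w 0 x ^ 2 + Ppot a γ (η 0 x)) ≤ E) {t : ℝ}
    (ht : 0 ≤ t) : ∫ x in (0 : ℝ)..1, |η t x * w t x| ≤ 1 / 2 + E := by
  have hc := h.continuous_energy_density ht
  have hη := h.cont_η.uncurry_left t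
  calc ∫ x in (0 : ℝ)..1, |η t x * w t x|
      ≤ ∫ x in (0 : ℝ)..1, ((1 / 2) * η t x
          + ((1 / 2) * η t x * w t x ^ 2 + Ppot a γ (η t x))) := by
        refine intervalIntegral.integral_mono_on zero_le_one
          ((h.continuous_momentum.uncurry_left t).abs.intervalIntegrable _ _)
          ((Continuous.intervalIntegrable (by fun_prop) _ _)) fun x _ => ?_
        have hp := h.pos t x ht
        have hP := Ppot_nonneg ha hγ hp
        rw [abs_mul, abs_of_pos hp, ← sq_abs]
        nlinarith [mul_nonneg hp.le (sq_nonneg (|w t x| - 1))]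
    _ ≤ 1 / 2 + E := by
        rw [intervalIntegral.integral_add (Continuous.intervalIntegrable (by fun_prop) _ _)
          (hc.intervalIntegrable _ _), intervalIntegral.integral_const_mul,
          h.integral_density ht, hmass, mul_one]
        linarith [h.integral_energy_le hν ht]

lemma le_integral_momentum_flux (h : IsPeriodicFlow a γ ν η ηt ηx w wt wx wxx) (ha : 0 < a)
    (hγ : 1 ≤ γ) (hmass : ∫ x in (0 : ℝ)..1, η 0 x = 1) {t : ℝ} (ht : 0 ≤ t) :
    a ≤ ∫ x in (0 : ℝ)..1, (η t x * w t x ^ 2 + a * η t x ^ γ - ν * wx t x) := by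
  have hη := h.cont_η.uncurry_left t
  have hwx := h.cont_wx.uncurry_left t
  have h1 : ∫ x in (0 : ℝ)..1, wx t x = 0 := by
    have hp := h.periodic_w t 0
    rw [zero_add] at hp
    rw [intervalIntegral.integral_eq_sub_of_hasDerivAt (fun x _ => h.deriv_wx t x)
      (hwx.intervalIntegrable _ _), hp, sub_self]
  have h2 : ∫ x in (0 : ℝ)..1, (a * (1 + γ * (η t x - 1)) - ν * wx t x) = a := by
    rw [intervalIntegral.integral_sub (Continuous.intervalIntegrable (by fun_prop) _ _)
      (Continuous.intervalIntegrable (by fun_prop) _ _), intervalIntegral.integral_const_mul,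
      intervalIntegral.integral_const_mul, h1,
      intervalIntegral.integral_add (Continuous.intervalIntegrable (by fun_prop) _ _)
      (Continuous.intervalIntegrable (by fun_prop) _ _), intervalIntegral.integral_const_mul,
      intervalIntegral.integral_sub (Continuous.intervalIntegrable (by fun_prop) _ _)
      (Continuous.intervalIntegrable (by fun_prop) _ _), h.integral_density ht, hmass]
    simp
  refine h2.symm.trans_le (intervalIntegral.integral_mono_on zero_le_one
    (Continuous.intervalIntegrable (by fun_prop) _ _)
    ((h.continuous_momentum_flux ht).intervalIntegrable _ _) fun x _ => ?_)
  have hp := h.pos t x ht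
  have hb := one_add_mul_self_le_rpow_one_add (s := η t x - 1) (by linarith) hγ
  rw [add_sub_cancel] at hb
  have : a * (1 + γ * (η t x - 1)) ≤ a * η t x ^ γ := by gcongr
  have : 0 ≤ η t x * w t x ^ 2 := by positivity
  linarith

end IsPeriodicFlow

/-- The primitive of the momentum `q` with zero mean over a period. -/
noncomputable def momentumPotential (q : ℝ → ℝ → ℝ) (t x : ℝ) : ℝ :=
  (∫ y in (0 : ℝ)..x, q t y) - ∫ z in (0 : ℝ)..1, ∫ y in (0 : ℝ)..z, q t y

section momentumPotential

variable {q qt : ℝ → ℝ → ℝ}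

lemma continuous_primitive_uncurry (hq : Continuous (uncurry q)) :
    Continuous (uncurry fun t x => ∫ y in (0 : ℝ)..x, q t y) :=
  intervalIntegral.continuous_parametric_primitive_of_continuous hq

lemma continuous_momentumPotential (hq : Continuous (uncurry q)) :
    Continuous (uncurry (momentumPotential q)) :=
  (continuous_primitive_uncurry hq).sub
    ((intervalIntegral.continuous_parametric_intervalIntegral_of_continuous'
      (continuous_primitive_uncurry hq) 0 1).comp continuous_fst)

lemma hasDerivAt_momentumPotential_space (hq : Continuous (uncurry q)) (t x : ℝ) :
    HasDerivAt (momentumPotential q t) (q t x) x :=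
  ((hq.uncurry_left t).integral_hasStrictDerivAt 0 x).hasDerivAt.sub_const _

lemma hasDerivAt_momentumPotential_time (hq : Continuous (uncurry q))
    (hqt : ∀ t x, HasDerivAt (fun s => q s x) (qt t x) t) (hqtc : Continuous (uncurry qt))
    (t x : ℝ) :
    HasDerivAt (fun s => momentumPotential q s x) (momentumPotential qt t x) t :=
  (hasDerivAt_integral_of_continuous (fun t => hq.uncurry_left t) hqt hqtc x t).sub
    (hasDerivAt_integral_of_continuous
      (fun t => (continuous_primitive_uncurry hq).uncurry_left t)
      (fun t z => hasDerivAt_integral_of_continuous (fun t => hq.uncurry_left t) hqt hqtc z t)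
      (continuous_primitive_uncurry hqtc) 1 t)

lemma momentumPotential_eq_of_primitive {F : ℝ → ℝ} {t : ℝ} (hq : Continuous (q t))
    (hF : ∀ x, HasDerivAt F (-q t x) x) (x : ℝ) :
    momentumPotential q t x = (∫ z in (0 : ℝ)..1, F z) - F x := by
  have h1 : ∀ z, ∫ y in (0 : ℝ)..z, q t y = F 0 - F z := fun z => by
    have := intervalIntegral.integral_eq_sub_of_hasDerivAt (a := 0) (b := z) (fun x _ => hF x)
      (hq.neg.intervalIntegrable _ _)
    rw [intervalIntegral.integral_neg] at this
    linarith
  have hFc : Continuous F := continuous_iff_continuousAt.2 fun x => (hF x).continuousAt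
  simp only [momentumPotential, h1]
  rw [intervalIntegral.integral_sub intervalIntegrable_const (hFc.intervalIntegrable _ _)]
  simp

lemma periodic_momentumPotential {t : ℝ} (hq : Continuous (q t)) (hper : Periodic (q t) 1)
    (hzero : ∫ y in (0 : ℝ)..1, q t y = 0) : Periodic (momentumPotential q t) 1 := fun x => by
  have h1 := hper.intervalIntegral_add_eq x 0
  rw [zero_add, hzero] at h1
  simp only [momentumPotential]
  rw [← intervalIntegral.integral_add_adjacent_intervals (hq.intervalIntegrable 0 x)
    (hq.intervalIntegrable x (x + 1)), h1, add_zero]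

lemma abs_momentumPotential_le {t : ℝ} (hq : Continuous (q t)) {x : ℝ}
    (hx : x ∈ Icc (0 : ℝ) 1) :
    |momentumPotential q t x| ≤ ∫ y in (0 : ℝ)..1, |q t y| := by
  have hpc : Continuous fun z => ∫ y in (0 : ℝ)..z, q t y :=
    continuous_iff_continuousAt.2 fun z =>
      (hq.integral_hasStrictDerivAt 0 z).hasDerivAt.continuousAt
  have e : momentumPotential q t x = ∫ z in (0 : ℝ)..1, ∫ y in z..x, q t y := by
    have : (fun z => ∫ y in z..x, q t y) =
        fun z => (∫ y in (0 : ℝ)..x, q t y) - ∫ y in (0 : ℝ)..z, q t y :=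
      funext fun z => (intervalIntegral.integral_interval_sub_left (hq.intervalIntegrable _ _)
        (hq.intervalIntegrable _ _)).symm
    rw [this, intervalIntegral.integral_sub intervalIntegrable_const (hpc.intervalIntegrable _ _)]
    simp [momentumPotential]
  rw [e, ← Real.norm_eq_abs]
  refine (intervalIntegral.norm_integral_le_of_norm_le_const
    (C := ∫ y in (0 : ℝ)..1, |q t y|) fun z hz => ?_).trans (by simp)
  rw [uIoc_of_le zero_le_one] at hz
  refine (intervalIntegral.norm_integral_le_integral_norm_uIoc).trans ?_
  rw [intervalIntegral.integral_of_le zero_le_one]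
  refine setIntegral_mono_set (hq.abs.integrableOn_Ioc)
    (Eventually.of_forall fun y => abs_nonneg _) (LE.le.eventuallyLE ?_)
  exact Ioc_subset_Ioc (le_min hz.1.le hx.1) (max_le hz.2 hx.2)

end momentumPotential

lemma IsPeriodicFlow.exp_le_density {a γ ν : ℝ} {η ηt ηx w wt wx wxx : ℝ → ℝ → ℝ}
    (h : IsPeriodicFlow a γ ν η ηt ηx w wt wx wxx) (ha : 0 < a) (hγ : 1 ≤ γ) (hν : 0 < ν)
    {ςlow E : ℝ} (hςlow : 0 < ςlow) (hlow : ∀ x, ςlow ≤ η 0 x)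
    (hmass : ∫ x in (0 : ℝ)..1, η 0 x = 1) (hmom : ∫ x in (0 : ℝ)..1, η 0 x * w 0 x = 0)
    (hE : ∫ x in (0 : ℝ)..1, ((1 / 2) * η 0 x * w 0 x ^ 2 + Ppot a γ (η 0 x)) ≤ E)
    {t : ℝ} (ht : 0 ≤ t) (x : ℝ) :
    Real.exp ((min (ν * Real.log ςlow) 0 - 2 * (1 / 2 + E)) / ν) ≤ η t x := by
  set φ := momentumPotential fun t x => η t x * w t x with hφ
  set φt := momentumPotential fun t x => ηt t x * w t x + η t x * wt t x with hφt
  have hq := h.continuous_momentum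
  have hqt := h.continuous_momentum_deriv
  have hφper : ∀ t, 0 ≤ t → Periodic (φ t) 1 := fun t ht =>
    periodic_momentumPotential (hq.uncurry_left t) ((h.periodic_η t).mul (h.periodic_w t))
      ((h.integral_momentum ht).trans hmom)
  have hφbound : ∀ t y, 0 ≤ t → |φ t y| ≤ 1 / 2 + E := fun t y ht => by
    have e := (hφper t ht).sub_int_mul_eq (x := y) ⌊y⌋
    rw [mul_one] at e
    rw [← e]
    exact (abs_momentumPotential_le (hq.uncurry_left t)
      ⟨Int.fract_nonneg y, (Int.fract_lt_one y).le⟩).trans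
      (h.integral_abs_momentum_le ha hγ hν hmass hE ht)
  have hmain : min (ν * Real.log ςlow) 0 - (1 / 2 + E) ≤ ν * Real.log (η t x) + φ t x := by
    refine le_of_critical_points (L := fun t x => ν * Real.log (η t x) + φ t x)
      (Lt := fun t x => ν * (ηt t x / η t x) + φt t x) ?_ (fun t ht => ?_) (fun y => ?_)
      (fun t y ht => ?_) (fun t y ht _ hcrit hlt => ?_) ht
    · exact (continuousOn_const.mul (h.cont_η.continuousOn.log
        fun p hp => (h.pos p.1 p.2 hp.1).ne')).add (continuous_momentumPotential hq).continuousOn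
    · intro y
      simp only [h.periodic_η t y, hφper t ht y]
    · have h1 := (abs_le.1 (hφbound 0 y le_rfl)).1
      have h2 : ν * Real.log ςlow ≤ ν * Real.log (η 0 y) := by
        gcongr
        exact hlow y
      linarith [min_le_left (ν * Real.log ςlow) 0]
    · exact (((h.deriv_ηt t y).log (h.pos t y ht.le).ne').const_mul ν).add
        (hasDerivAt_momentumPotential_time hq
          (fun t x => (h.deriv_ηt t x).mul (h.deriv_wt t x)) hqt t y)
    · have hp := h.pos t y ht.le
      have h1 : ν * (ηx t y / η t y) + η t y * w t y = 0 := by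
        rw [← hcrit]
        exact ((((h.deriv_ηx t y).log hp.ne').const_mul ν).add
          (hasDerivAt_momentumPotential_space hq t y)).deriv.symm
      have h2 : φt t y = _ := momentumPotential_eq_of_primitive (hqt.uncurry_left t)
        (h.hasDerivAt_momentum_flux ht.le) y
      have h3 := h.le_integral_momentum_flux ha hγ hmass ht.le
      have h4 : ηt t y / η t y = -(ηx t y / η t y * w t y) - wx t y := by
        field_simp
        linear_combination h.mass t y ht.le
      have hlog : Real.log (η t y) < 0 := by
        have h5 := (abs_le.1 (hφbound t y ht.le)).1
        have h6 : ν * Real.log (η t y) < 0 := by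
          linarith [min_le_right (ν * Real.log ςlow) 0]
        exact neg_of_mul_neg_right h6 hν.le
      have h7 : a * η t y ^ γ ≤ a := by
        have := Real.rpow_le_one hp.le ((Real.log_neg_iff hp).1 hlog).le (by linarith : 0 ≤ γ)
        nlinarith
      have h8 : ν * (ηt t y / η t y) + φt t y =
          (∫ x in (0 : ℝ)..1, (η t x * w t x ^ 2 + a * η t x ^ γ - ν * wx t x))
            - a * η t y ^ γ := by
        rw [h2, h4]
        linear_combination -w t y * h1
      rw [h8]
      linarith
  have hb := (abs_le.1 (hφbound t x ht)).2
  rw [← Real.le_log_iff_exp_le (h.pos t x ht), div_le_iff₀ hν]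
  linarith

/-- **Uniform-in-time strictly positive lower bound for the density**
(Proposition `prop-lowerbd-density`): there is `η̲ > 0`, depending only on
`(a, γ, ν, ς̄₀, ς̲₀, Ē)`, such that every global smooth solution of the 1D
isentropic compressible Navier–Stokes system on `[0,∞) × 𝕋` with
`ς̲₀ ≤ η₀ ≤ ς̄₀`, `∫_𝕋 η₀ = 1`, `∫_𝕋 η₀ w₀ = 0` and initial energy `E₀₀ ≤ Ē`
satisfies `η(t,x) ≥ η̲` for all `t ≥ 0` and all `x`.
Functions on `𝕋 = ℝ/ℤ` are modelled as `1`-periodic functions of `x`. -/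
theorem density_lower_bound (a γ ν ςlow ςbar Ebar : ℝ)
    (ha : 0 < a) (hγ1 : 1 ≤ γ) (hγ2 : γ ≤ 2) (hν : 0 < ν)
    (hςlow : 0 < ςlow) (hςord : ςlow ≤ ςbar) (hEbar : 0 < Ebar) :
    ∃ ηlow : ℝ, 0 < ηlow ∧
      ∀ η w : ℝ → ℝ → ℝ,
        ContDiff ℝ (⊤ : ℕ∞) (Function.uncurry η) →
        ContDiff ℝ (⊤ : ℕ∞) (Function.uncurry w) →
        (∀ t x : ℝ, η t (x + 1) = η t x) →
        (∀ t x : ℝ, w t (x + 1) = w t x) →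
        (∀ t x : ℝ, 0 ≤ t → 0 < η t x) →
        (∀ t x : ℝ, 0 ≤ t →
          deriv (fun s => η s x) t + deriv (fun y => η t y * w t y) x = 0) →
        (∀ t x : ℝ, 0 ≤ t →
          η t x * (deriv (fun s => w s x) t + w t x * deriv (w t) x)
            - ν * deriv (deriv (w t)) x + deriv (fun y => a * η t y ^ γ) x = 0) →
        (∀ x : ℝ, ςlow ≤ η 0 x) →
        (∀ x : ℝ, η 0 x ≤ ςbar) →
        (∫ x in (0:ℝ)..1, η 0 x) = 1 →
        (∫ x in (0:ℝ)..1, η 0 x * w 0 x) = 0 →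
        (∫ x in (0:ℝ)..1, ((1 / 2) * η 0 x * (w 0 x) ^ 2 + Ppot a γ (η 0 x))) ≤ Ebar →
        ∀ t x : ℝ, 0 ≤ t → ηlow ≤ η t x := by
  refine ⟨Real.exp ((min (ν * Real.log ςlow) 0 - 2 * (1 / 2 + Ebar)) / ν), Real.exp_pos _, ?_⟩
  intro η w hη hw hηper hwper hpos hmass hmom hlow _ hint hint0 hE t x ht
  obtain ⟨ηt, ηx, hηt, hηx, dηt, dηx⟩ := exists_partial_derivatives hη
  obtain ⟨wt, wx, hwt, hwx, dwt, dwx⟩ := exists_partial_derivatives hw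
  obtain ⟨-, wxx, -, hwxx, -, dwxx⟩ := exists_partial_derivatives hwx
  have flow : IsPeriodicFlow a γ ν η ηt ηx w wt wx wxx :=
    { cont_η := hη.continuous
      cont_ηt := hηt.continuous
      cont_ηx := hηx.continuous
      cont_w := hw.continuous
      cont_wt := hwt.continuous
      cont_wx := hwx.continuous
      cont_wxx := hwxx.continuous
      deriv_ηt := dηt
      deriv_ηx := dηx
      deriv_wt := dwt
      deriv_wx := dwx
      deriv_wxx := dwxx
      periodic_η := hηper
      periodic_w := hwper
      pos := hpos
      mass := fun t x ht => by
        have := hmass t x ht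
        rwa [(dηt t x).deriv, ((dηx t x).fun_mul (dwx t x)).deriv] at this
      momentum := fun t x ht => by
        have := hmom t x ht
        rwa [(dwt t x).deriv, show deriv (w t) = wx t from funext fun y => (dwx t y).deriv,
          (dwxx t x).deriv, (hasDerivAt_pressure a γ (dηx t x) (hpos t x ht)).deriv] at this }
  exact flow.exp_le_density ha hγ1 hν hςlow hlow hint hint0 hE ht x
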